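/- Sandwich bounds on the marginal gain of GED-Walk: if α·σ_max < 1 with α > 0, then for every S ⊆ V, every x ∈ V, and every ℓ ≥ 1, GED_{≤ℓ}(S ∪ {x}) − GED_{≤ℓ}(S) ≤ GED(S ∪ {x}) − GED(S) ≤ GED_{≤ℓ}(S ∪ {x}) − GED_{≤ℓ}(S) + GED_{>ℓ}(V). -/

import Mathlib

open scoped BigOperators

/-- `p : Fin (i+1) → V` is a walk of length `i` in `G`:
a sequence of `i+1` vertices in which consecutive vertices are adjacent. -/
def SimpleGraph.IsWalkFun {V : Type*} (G : SimpleGraph V) (i : ℕ) (p : Fin (i + 1) → V) : Prop :=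
  ∀ j : Fin i, G.Adj (p j.castSucc) (p j.succ)

instance {V : Type*} (G : SimpleGraph V) [DecidableRel G.Adj] (i : ℕ) :
    DecidablePred (G.IsWalkFun i) := fun p =>
  decidable_of_iff (∀ j : Fin i, G.Adj (p j.castSucc) (p j.succ)) Iff.rfl

/-- `φ_i(S)`: the number of walks of length `i` in `G` containing at least one vertex of `S`. -/
def SimpleGraph.phiCount {V : Type*} [Fintype V] [DecidableEq V] (G : SimpleGraph V)
    [DecidableRel G.Adj] (i : ℕ) (S : Finset V) : ℕ :=
  (Finset.univ.filter fun p : Fin (i + 1) → V => G.IsWalkFun i p ∧ ∃ j, p j ∈ S).card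

/-- The total number of walks of length `i` in `G`. -/
def SimpleGraph.walkCount {V : Type*} [Fintype V] [DecidableEq V] (G : SimpleGraph V)
    [DecidableRel G.Adj] (i : ℕ) : ℕ :=
  (Finset.univ.filter fun p : Fin (i + 1) → V => G.IsWalkFun i p).card

/-- `φ^miss_i(v, S)`: the number of walks of length `i` ending at `v` containing no vertex of `S`. -/
def SimpleGraph.missCount {V : Type*} [Fintype V] [DecidableEq V] (G : SimpleGraph V)
    [DecidableRel G.Adj] (i : ℕ) (v : V) (S : Finset V) : ℕ :=
  (Finset.univ.filter fun p : Fin (i + 1) → V =>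
    G.IsWalkFun i p ∧ p (Fin.last i) = v ∧ ∀ j, p j ∉ S).card

/-- `φ^hit_i(v, S)`: the number of walks of length `i` ending at `v` containing at least one
vertex of `S`. -/
def SimpleGraph.hitCount {V : Type*} [Fintype V] [DecidableEq V] (G : SimpleGraph V)
    [DecidableRel G.Adj] (i : ℕ) (v : V) (S : Finset V) : ℕ :=
  (Finset.univ.filter fun p : Fin (i + 1) → V =>
    G.IsWalkFun i p ∧ p (Fin.last i) = v ∧ ∃ j, p j ∈ S).card

/-- `s_j(x, S)`: the number of walks of length `j` starting at `x` containing no vertex of `S`. -/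
def SimpleGraph.startMissCount {V : Type*} [Fintype V] [DecidableEq V] (G : SimpleGraph V)
    [DecidableRel G.Adj] (j : ℕ) (x : V) (S : Finset V) : ℕ :=
  (Finset.univ.filter fun p : Fin (j + 1) → V =>
    G.IsWalkFun j p ∧ p 0 = x ∧ ∀ l, p l ∉ S).card

/-- `σ_max`: the largest singular value of the adjacency matrix of `G`,
i.e. its ℓ²→ℓ² operator norm. -/
noncomputable def SimpleGraph.sigmaMax {V : Type*} [Fintype V] [DecidableEq V]
    (G : SimpleGraph V) [DecidableRel G.Adj] : ℝ :=
  ‖Matrix.toEuclideanCLM (𝕜 := ℝ) (G.adjMatrix ℝ)‖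

/-- `ω_i(x) = Σ_z (A^i)_{xz}`: the number of walks of length `i` starting at `x`. -/
noncomputable def SimpleGraph.omegaCount {V : Type*} [Fintype V] [DecidableEq V]
    (G : SimpleGraph V) [DecidableRel G.Adj] (i : ℕ) (x : V) : ℝ :=
  ∑ z : V, (G.adjMatrix ℝ ^ i) x z

/-- `GED(S) = Σ_{i=1}^∞ α^i φ_i(S)`. -/
noncomputable def SimpleGraph.GED {V : Type*} [Fintype V] [DecidableEq V] (G : SimpleGraph V)
    [DecidableRel G.Adj] (α : ℝ) (S : Finset V) : ℝ :=
  ∑' i : ℕ, α ^ (i + 1) * (G.phiCount (i + 1) S : ℝ)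

/-- `GED_{≤ℓ}(S) = Σ_{i=1}^ℓ α^i φ_i(S)`. -/
noncomputable def SimpleGraph.GEDle {V : Type*} [Fintype V] [DecidableEq V] (G : SimpleGraph V)
    [DecidableRel G.Adj] (α : ℝ) (ℓ : ℕ) (S : Finset V) : ℝ :=
  ∑ i ∈ Finset.range ℓ, α ^ (i + 1) * (G.phiCount (i + 1) S : ℝ)

/-- `GED_{>ℓ}(S) = Σ_{i=ℓ+1}^∞ α^i φ_i(S)`. -/
noncomputable def SimpleGraph.GEDtail {V : Type*} [Fintype V] [DecidableEq V] (G : SimpleGraph V)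
    [DecidableRel G.Adj] (α : ℝ) (ℓ : ℕ) (S : Finset V) : ℝ :=
  ∑' i : ℕ, α ^ (ℓ + 1 + i) * (G.phiCount (ℓ + 1 + i) S : ℝ)

/-- `KC(x) = Σ_{i=1}^∞ α^i ω_i(x)`: Katz centrality of `x`. -/
noncomputable def SimpleGraph.katz {V : Type*} [Fintype V] [DecidableEq V] (G : SimpleGraph V)
    [DecidableRel G.Adj] (α : ℝ) (x : V) : ℝ :=
  ∑' i : ℕ, α ^ (i + 1) * G.omegaCount (i + 1) x
namespace SimpleGraph

variable {V : Type*} (G : SimpleGraph V)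

theorem isWalkFun_cons_cons (i : ℕ) (v w : V) (q : Fin i → V) :
    G.IsWalkFun (i + 1) (Fin.cons v (Fin.cons w q : Fin (i + 1) → V) : Fin (i + 2) → V) ↔
      G.Adj v w ∧ G.IsWalkFun i (Fin.cons w q : Fin (i + 1) → V) := by
  simp only [IsWalkFun, Fin.forall_fin_succ (n := i), Fin.castSucc_zero, Fin.cons_zero,
    Fin.cons_succ, ← Fin.succ_castSucc]

variable [Fintype V] [DecidableEq V] [DecidableRel G.Adj]

/-- The walks of length `i` starting at `v` are counted by the `v`-th row sum of `A ^ i`. -/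
theorem sum_isWalkFun_cons (i : ℕ) (v : V) :
    ∑ q : Fin i → V, (if G.IsWalkFun i (Fin.cons v q : Fin (i + 1) → V) then (1 : ℝ) else 0) =
      (G.adjMatrix ℝ ^ i).mulVec 1 v := by
  induction i generalizing v with
  | zero => simp [IsWalkFun]
  | succ i ih =>
    rw [← (Fin.consEquiv fun _ : Fin (i + 1) => V).sum_comp, Fintype.sum_prod_type, pow_succ',
      ← Matrix.mulVec_mulVec]
    refine Finset.sum_congr rfl fun w _ => ?_
    rw [← ih, Finset.mul_sum]
    refine Finset.sum_congr rfl fun q _ => ?_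
    by_cases hvw : G.Adj v w <;>
      simp [Fin.consEquiv, isWalkFun_cons_cons, adjMatrix_apply, hvw]

theorem walkCount_eq (i : ℕ) :
    (G.walkCount i : ℝ) = (1 : V → ℝ) ⬝ᵥ (G.adjMatrix ℝ ^ i).mulVec 1 := by
  rw [walkCount, Finset.card_filter, Nat.cast_sum,
    ← (Fin.consEquiv fun _ : Fin (i + 1) => V).sum_comp, Fintype.sum_prod_type, one_dotProduct]
  refine Finset.sum_congr rfl fun v _ => ?_
  rw [← sum_isWalkFun_cons]
  exact Finset.sum_congr rfl fun q _ => by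
    rw [Nat.cast_ite, Nat.cast_one, Nat.cast_zero]
    rfl

theorem walkCount_le (i : ℕ) :
    (G.walkCount i : ℝ) ≤ Fintype.card V * G.sigmaMax ^ i := by
  set T := Matrix.toEuclideanCLM (𝕜 := ℝ) (G.adjMatrix ℝ) with hT
  set e : EuclideanSpace ℝ V := WithLp.toLp 2 1 with he
  have hcard : ‖e‖ * ‖e‖ = Fintype.card V := by
    rw [← real_inner_self_eq_norm_mul_norm, PiLp.inner_apply]
    simp [he]
  have hw : (G.walkCount i : ℝ) = inner ℝ e ((T ^ i) e) := by
    rw [walkCount_eq, hT, ← map_pow, he, Matrix.toEuclideanCLM_toLp,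
      EuclideanSpace.inner_toLp_toLp, star_trivial, dotProduct_comm]
  have hpow : ‖(T ^ i) e‖ ≤ ‖T‖ ^ i * ‖e‖ := by
    clear hw
    induction i with
    | zero => simp
    | succ i ih =>
      rw [pow_succ', pow_succ', mul_assoc]
      exact (T.le_opNorm _).trans (mul_le_mul_of_nonneg_left ih (norm_nonneg T))
  calc (G.walkCount i : ℝ) ≤ ‖e‖ * ‖(T ^ i) e‖ := hw ▸ real_inner_le_norm _ _
    _ ≤ ‖e‖ * (‖T‖ ^ i * ‖e‖) := by gcongr
    _ = Fintype.card V * G.sigmaMax ^ i := by rw [← hcard, sigmaMax]; ring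

theorem phiCount_le_walkCount (i : ℕ) (S : Finset V) : G.phiCount i S ≤ G.walkCount i :=
  Finset.card_le_card (Finset.monotone_filter_right _ fun _ _ hp => hp.1)

theorem phiCount_mono (i : ℕ) {S T : Finset V} (hST : S ⊆ T) :
    G.phiCount i S ≤ G.phiCount i T :=
  Finset.card_le_card (Finset.monotone_filter_right _ fun _ _ hp =>
    ⟨hp.1, hp.2.imp fun _ hj => hST hj⟩)

theorem summable_phiCount {α : ℝ} (hα : 0 ≤ α) (h : α * G.sigmaMax < 1) (S : Finset V) :
    Summable fun i : ℕ => α ^ i * (G.phiCount i S : ℝ) := by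
  have hσ : 0 ≤ α * G.sigmaMax := mul_nonneg hα (norm_nonneg _)
  refine Summable.of_nonneg_of_le (fun i => by positivity) (fun i => ?_)
    ((summable_geometric_of_lt_one hσ h).mul_left (Fintype.card V : ℝ))
  calc α ^ i * (G.phiCount i S : ℝ) ≤ α ^ i * (Fintype.card V * G.sigmaMax ^ i) := by
        gcongr
        exact (Nat.cast_le.2 (G.phiCount_le_walkCount i S)).trans (G.walkCount_le i)
    _ = Fintype.card V * (α * G.sigmaMax) ^ i := by rw [mul_pow]; ring

theorem summable_phiCount_tail {α : ℝ} (hα : 0 ≤ α) (h : α * G.sigmaMax < 1) (ℓ : ℕ)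
    (S : Finset V) :
    Summable fun i : ℕ => α ^ (ℓ + 1 + i) * (G.phiCount (ℓ + 1 + i) S : ℝ) :=
  (G.summable_phiCount hα h S).comp_injective (add_right_injective (ℓ + 1))

theorem GED_eq_GEDle_add_GEDtail {α : ℝ} (hα : 0 ≤ α) (h : α * G.sigmaMax < 1) (ℓ : ℕ)
    (S : Finset V) : G.GED α S = G.GEDle α ℓ S + G.GEDtail α ℓ S := by
  have hs := (summable_nat_add_iff 1).2 (G.summable_phiCount hα h S)
  rw [GED, GEDle, GEDtail, ← hs.sum_add_tsum_nat_add ℓ]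
  congr 1
  refine tsum_congr fun i => ?_
  rw [show i + ℓ + 1 = ℓ + 1 + i by ring]

theorem GEDtail_mono {α : ℝ} (hα : 0 ≤ α) (h : α * G.sigmaMax < 1) (ℓ : ℕ)
    {S T : Finset V} (hST : S ⊆ T) : G.GEDtail α ℓ S ≤ G.GEDtail α ℓ T :=
  (G.summable_phiCount_tail hα h ℓ S).tsum_le_tsum (fun i => by
    gcongr
    exact G.phiCount_mono _ hST) (G.summable_phiCount_tail hα h ℓ T)

theorem GEDtail_nonneg {α : ℝ} (hα : 0 ≤ α) (ℓ : ℕ) (S : Finset V) : 0 ≤ G.GEDtail α ℓ S :=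
  tsum_nonneg fun i => by positivity

end SimpleGraph

/-- sandwich bounds on the marginal gain of GED-Walk. -/
theorem ged_marginal_gain_sandwich {V : Type*} [Fintype V] [DecidableEq V]
    (G : SimpleGraph V) [DecidableRel G.Adj] (α : ℝ) (hα : 0 < α)
    (h : α * G.sigmaMax < 1) (S : Finset V) (x : V) (ℓ : ℕ) (hℓ : 1 ≤ ℓ) :
    G.GEDle α ℓ (insert x S) - G.GEDle α ℓ S ≤ G.GED α (insert x S) - G.GED α S ∧
      G.GED α (insert x S) - G.GED α S ≤
        G.GEDle α ℓ (insert x S) - G.GEDle α ℓ S + G.GEDtail α ℓ Finset.univ := by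
  have hα' := hα.le
  rw [G.GED_eq_GEDle_add_GEDtail hα' h ℓ S, G.GED_eq_GEDle_add_GEDtail hα' h ℓ (insert x S)]
  have h₁ := G.GEDtail_mono hα' h ℓ (Finset.subset_insert x S)
  have h₂ := G.GEDtail_mono hα' h ℓ (Finset.subset_univ (insert x S))
  have h₃ := G.GEDtail_nonneg hα' ℓ S
  constructor <;> linarith
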